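/- arXiv:1808.09490 — 5 statements merged into one kernel-verified Lean document; each statement's English description precedes it below -/
import Mathlib

section
/- Let Z be a 3×3 real matrix, let α ∈ ℝ and a = (a₁,a₂,a₃) ∈ ℝ³ \ {0} satisfy Z a = α a, and let β ∈ ℂ \ ℝ and b = (b₁,b₂,b₃) ∈ ℂ³ \ {0} satisfy Z b = β b (with Z acting on ℂ³ entrywise). Then the three vectors vᵢ = (aᵢ, Re bᵢ, Im bᵢ) ∈ ℝ³, i = 1,2,3, are linearly independent over ℝ; equivalently, the 3×3 real matrix whose i-th row is (aᵢ, Re bᵢ, Im bᵢ) is invertible. -/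
section RealMatrixComplexEigenvector

variable {n : Type*} [Fintype n] {Z : Matrix n n ℝ} {β : ℂ} {b : n → ℂ}

/-- A real matrix sends the real part of a multiple of a complex eigenvector to the real part of
the multiple scaled by the eigenvalue. -/
theorem Matrix.mulVec_re_mul_of_map_mulVec_eq_smul
    (hZb : (Z.map ((↑) : ℝ → ℂ)).mulVec b = β • b) (u : ℂ) :
    Z.mulVec (fun i => (u * b i).re) = fun i => (u * β * b i).re := by
  funext i
  have h : ∑ j, (Z i j : ℂ) * b j = β * b i := by
    simpa [Matrix.mulVec, dotProduct] using congrFun hZb i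
  rw [mul_assoc, ← h, Finset.mul_sum, Complex.re_sum]
  refine Finset.sum_congr rfl fun j _ => ?_
  rw [mul_left_comm, Complex.re_ofReal_mul]

/-- No nonzero complex multiple of an eigenvector of a real matrix for a non-real eigenvalue is
purely imaginary. -/
theorem Matrix.eq_zero_of_re_mul_eigenvector_eq_zero
    (hZb : (Z.map ((↑) : ℝ → ℂ)).mulVec b = β • b) (hβ : β.im ≠ 0) (hb : b ≠ 0) {u : ℂ}
    (hu : ∀ i, (u * b i).re = 0) : u = 0 := by
  by_contra hu0
  refine hb (funext fun i => ?_)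
  have h := congrFun (Matrix.mulVec_re_mul_of_map_mulVec_eq_smul hZb u) i
  have hzero : (fun i => (u * b i).re) = 0 := funext hu
  rw [hzero, Matrix.mulVec_zero, Pi.zero_apply, mul_right_comm, Complex.mul_re, hu i, zero_mul,
    zero_sub, eq_comm, neg_eq_zero] at h
  have him := (mul_eq_zero.mp h).resolve_right hβ
  exact (mul_eq_zero.mp (Complex.ext (hu i) him)).resolve_left hu0

end RealMatrixComplexEigenvector

/-- If `Z` is a real 3×3 matrix with real eigenvector `a ≠ 0` for a real
eigenvalue `α`, and a complex eigenvector `b ≠ 0` for a non-real eigenvalue `β`, then the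
three vectors `vᵢ = (aᵢ, Re bᵢ, Im bᵢ) ∈ ℝ³` are linearly independent over `ℝ`;
equivalently, the 3×3 real matrix whose `i`-th row is `(aᵢ, Re bᵢ, Im bᵢ)` is invertible. -/
theorem inoue_lattice_vectors_linearIndependent (Z : Matrix (Fin 3) (Fin 3) ℝ)
    (α : ℝ) (a : Fin 3 → ℝ) (ha : a ≠ 0) (hZa : Z.mulVec a = α • a)
    (β : ℂ) (hβ : β.im ≠ 0) (b : Fin 3 → ℂ) (hb : b ≠ 0)
    (hZb : (Z.map ((↑) : ℝ → ℂ)).mulVec b = β • b) :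
    LinearIndependent ℝ (fun i : Fin 3 => ![a i, (b i).re, (b i).im]) ∧
    IsUnit (Matrix.of fun i : Fin 3 => ![a i, (b i).re, (b i).im]) := by
  have hunit : IsUnit (Matrix.of fun i : Fin 3 => ![a i, (b i).re, (b i).im]) := by
    rw [← Matrix.mulVec_injective_iff_isUnit]
    refine (injective_iff_map_eq_zero (Matrix.mulVecLin _)).mpr fun c hc => ?_
    have hrel (i : Fin 3) : ((⟨c 1, -c 2⟩ : ℂ) * b i).re = -c 0 * a i := by
      have h := congrFun hc i
      simp [Matrix.mulVec, dotProduct, Fin.sum_univ_three] at h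
      simp only [Complex.mul_re]
      linarith
    have hZrel (i : Fin 3) : ((⟨c 1, -c 2⟩ : ℂ) * β * b i).re = α * (-c 0 * a i) := by
      have h := congrFun (Matrix.mulVec_re_mul_of_map_mulVec_eq_smul hZb ⟨c 1, -c 2⟩) i
      have hw : (fun i => ((⟨c 1, -c 2⟩ : ℂ) * b i).re) = (-c 0) • a := funext hrel
      rw [← h, hw, Matrix.mulVec_smul, hZa]
      simp only [Pi.smul_apply, smul_eq_mul]
      ring
    have hprod : (⟨c 1, -c 2⟩ : ℂ) * (β - α) = 0 := by
      refine Matrix.eq_zero_of_re_mul_eigenvector_eq_zero hZb hβ hb fun i => ?_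
      rw [mul_sub, sub_mul, Complex.sub_re, hZrel, mul_right_comm, Complex.re_mul_ofReal, hrel]
      ring
    have hne : β - α ≠ 0 := fun h => hβ (by simpa using congrArg Complex.im h)
    have hγ := (mul_eq_zero.mp hprod).resolve_right hne
    have h1 : c 1 = 0 := congrArg Complex.re hγ
    have h2 : c 2 = 0 := neg_eq_zero.mp (congrArg Complex.im hγ)
    obtain ⟨i, hi⟩ := Function.ne_iff.mp ha
    have h0 : c 0 = 0 := by
      have h := hrel i
      rw [hγ, zero_mul, Complex.zero_re, eq_comm, mul_eq_zero] at h
      exact neg_eq_zero.mp (h.resolve_right hi)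
    funext j
    fin_cases j
    exacts [h0, h1, h2]
  exact ⟨Matrix.linearIndependent_rows_iff_isUnit.mpr hunit, hunit⟩
end

section
/- In the Inoue setup, for each i ∈ {1,2,3} one has the identity of bijections of ℂ × ℂ: g₀ ∘ gᵢ ∘ g₀⁻¹ = g₁^{Z_{i1}} ∘ g₂^{Z_{i2}} ∘ g₃^{Z_{i3}}, where for an integer k the k-th power of a translation gⱼ(w,z) = (w + aⱼ, z + bⱼ) is the translation by (k·aⱼ, k·bⱼ). Equivalently, for all (w,z) ∈ ℂ × ℂ, g₀(gᵢ(g₀⁻¹(w,z))) = (w + Σⱼ Z_{ij} aⱼ, z + Σⱼ Z_{ij} bⱼ). -/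
open scoped Matrix

/-- In the Inoue setup, for each `i ∈ {1,2,3}` one has the identity of
bijections of `ℂ × ℂ`:  `g₀ ∘ gᵢ ∘ g₀⁻¹ = g₁^{Z_{i1}} ∘ g₂^{Z_{i2}} ∘ g₃^{Z_{i3}}`,
i.e. for all `(w,z) ∈ ℂ × ℂ`,
`g₀(gᵢ(g₀⁻¹(w,z))) = (w + Σⱼ Z_{ij} aⱼ, z + Σⱼ Z_{ij} bⱼ)`. -/
theorem inoue_conjugation_identity (Z : Matrix (Fin 3) (Fin 3) ℤ) (hdet : Z.det = 1)
    (α : ℝ) (hα : 1 < α) (a : Fin 3 → ℝ) (ha : a ≠ 0)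
    (hZa : (Z.map ((↑) : ℤ → ℝ)).mulVec a = α • a)
    (β : ℂ) (hβ : β.im ≠ 0) (b : Fin 3 → ℂ) (hb : b ≠ 0)
    (hZb : (Z.map ((↑) : ℤ → ℂ)).mulVec b = β • b)
    (g₀ : ℂ × ℂ → ℂ × ℂ) (hg₀ : ∀ p, g₀ p = ((α : ℂ) * p.1, β * p.2))
    (g₀inv : ℂ × ℂ → ℂ × ℂ) (hg₀inv : ∀ p, g₀inv p = ((α : ℂ)⁻¹ * p.1, β⁻¹ * p.2))
    (g : Fin 3 → ℂ × ℂ → ℂ × ℂ) (hg : ∀ i p, g i p = (p.1 + (a i : ℂ), p.2 + b i)) :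
    ∀ (i : Fin 3) (p : ℂ × ℂ),
      g₀ (g i (g₀inv p)) =
        (p.1 + ((∑ j, (Z i j : ℝ) * a j : ℝ) : ℂ), p.2 + ∑ j, (Z i j : ℂ) * b j) := by
  intro i p
  have hα0 : (α : ℂ) ≠ 0 := by exact_mod_cast (zero_lt_one.trans hα).ne'
  have hβ0 : β ≠ 0 := by
    rintro rfl
    exact hβ Complex.zero_im
  have sum_a : ∑ j, (Z i j : ℝ) * a j = α * a i := congrFun hZa i
  have sum_b : ∑ j, (Z i j : ℂ) * b j = β * b i := congrFun hZb i
  rw [sum_a, sum_b, hg₀inv, hg, hg₀]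
  simp only [mul_add, mul_inv_cancel_left₀ hα0, mul_inv_cancel_left₀ hβ0, Complex.ofReal_mul]
end

section
/- In the Inoue setup, let G_Z be the subgroup of bijections of ℍ × ℂ generated by g₀, g₁, g₂, g₃. Then the action of G_Z on ℍ × ℂ is free (no element other than the identity has a fixed point) and properly discontinuous: for every pair of compact subsets K, L ⊆ ℍ × ℂ, the set {g ∈ G_Z : g(K) ∩ L ≠ ∅} is finite. -/
noncomputable section

/-- The product `ℍ × ℂ` of the upper half-plane with the complex plane, with the
subspace/product topology. -/
abbrev InoueHC : Type := {w : ℂ // 0 < w.im} × ℂ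

/-- The translation `(w, z) ↦ (w + c, z + d)` (with `c` real) as a bijection of `ℍ × ℂ`. -/
def inoueTransl (c : ℝ) (d : ℂ) : Equiv.Perm InoueHC where
  toFun p := (⟨p.1.1 + (c : ℂ), by simpa using p.1.2⟩, p.2 + d)
  invFun p := (⟨p.1.1 - (c : ℂ), by simpa using p.1.2⟩, p.2 - d)
  left_inv p := by simp [Prod.ext_iff, Subtype.ext_iff]
  right_inv p := by simp [Prod.ext_iff, Subtype.ext_iff]

/-- The map `g₀ : (w, z) ↦ (α w, β z)` (with `α > 1` real and `β` non-real) as a bijection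
of `ℍ × ℂ`. -/
def inoueDilat (α : ℝ) (β : ℂ) (hα : 1 < α) (hβ : β.im ≠ 0) : Equiv.Perm InoueHC where
  toFun p := (⟨(α : ℂ) * p.1.1, by
      rw [Complex.im_ofReal_mul]
      exact mul_pos (lt_trans one_pos hα) p.1.2⟩, β * p.2)
  invFun p := (⟨((α⁻¹ : ℝ) : ℂ) * p.1.1, by
      rw [Complex.im_ofReal_mul]
      exact mul_pos (inv_pos.mpr (lt_trans one_pos hα)) p.1.2⟩, β⁻¹ * p.2)
  left_inv p := by
    have hα0 : (α : ℂ) ≠ 0 := by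
      exact_mod_cast ne_of_gt (lt_trans one_pos hα)
    have hβ0 : β ≠ 0 := fun h => hβ (by rw [h, Complex.zero_im])
    simp [Prod.ext_iff, Subtype.ext_iff, ← mul_assoc, Complex.ofReal_inv,
      inv_mul_cancel₀ hα0, inv_mul_cancel₀ hβ0]
  right_inv p := by
    have hα0 : (α : ℂ) ≠ 0 := by
      exact_mod_cast ne_of_gt (lt_trans one_pos hα)
    have hβ0 : β ≠ 0 := fun h => hβ (by rw [h, Complex.zero_im])
    simp [Prod.ext_iff, Subtype.ext_iff, ← mul_assoc, Complex.ofReal_inv,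
      mul_inv_cancel₀ hα0, mul_inv_cancel₀ hβ0]

open Matrix in
/-- Integer row vectors pair with an eigenvector of `Z` equivariantly for powers of `Z`. -/
theorem eigenvector_zpow_mul_dotProduct {F : Type*} [Field F] (Z : Matrix (Fin 3) (Fin 3) ℤ)
    (hdet : Z.det = 1) {β : F} (hβ : β ≠ 0) {b : Fin 3 → F}
    (hZb : (Z.map ((↑) : ℤ → F)).mulVec b = β • b) (n : ℤ) (v : Fin 3 → ℤ) :
    β ^ n * ((fun i => (v i : F)) ⬝ᵥ b) = (fun i => ((v ᵥ* Z ^ n) i : F)) ⬝ᵥ b := by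
  have hunit : IsUnit Z.det := by simp [hdet]
  have step : ∀ u : Fin 3 → ℤ,
      (fun i => ((u ᵥ* Z) i : F)) ⬝ᵥ b = β * ((fun i => (u i : F)) ⬝ᵥ b) := by
    intro u
    have h : (fun i => ((u ᵥ* Z) i : F)) = (fun i => (u i : F)) ᵥ* Z.map ((↑) : ℤ → F) := by
      ext i
      simp [Matrix.vecMul, dotProduct]
    rw [h, ← Matrix.dotProduct_mulVec, hZb, dotProduct_smul, smul_eq_mul]
  induction n with
  | zero => simp
  | succ n ih =>
    rw [Matrix.zpow_add_one hunit, ← Matrix.vecMul_vecMul, step, ← ih, zpow_add_one₀ hβ]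
    ring
  | pred n ih =>
    have h := step (v ᵥ* Z ^ (-(n : ℤ) - 1))
    rw [Matrix.vecMul_vecMul, ← Matrix.zpow_add_one hunit, sub_add_cancel, ← ih] at h
    rw [zpow_sub_one₀ hβ, mul_right_comm, h]
    field_simp

/-- The map `(w, z) ↦ (αⁿ w + v ⬝ a, βⁿ z + v ⬝ b)` is the normal form of elements of `G_Z`. -/
def IsInoueAffine (α : ℝ) (a : Fin 3 → ℝ) (β : ℂ) (b : Fin 3 → ℂ) (n : ℤ) (v : Fin 3 → ℤ)
    (g : Equiv.Perm InoueHC) : Prop :=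
  ∀ p, (g p).1.1 = (α : ℂ) ^ n * p.1.1 + (((fun i => (v i : ℝ)) ⬝ᵥ a : ℝ) : ℂ) ∧
    (g p).2 = β ^ n * p.2 + (fun i => (v i : ℂ)) ⬝ᵥ b

theorem IsInoueAffine.ext {α : ℝ} {a : Fin 3 → ℝ} {β : ℂ} {b : Fin 3 → ℂ} {n : ℤ}
    {v : Fin 3 → ℤ} {g h : Equiv.Perm InoueHC} (hg : IsInoueAffine α a β b n v g)
    (hh : IsInoueAffine α a β b n v h) : g = h := by
  ext1 p
  exact Prod.ext (Subtype.ext ((hg p).1.trans (hh p).1.symm)) ((hg p).2.trans (hh p).2.symm)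

open Matrix in
theorem exists_isInoueAffine_of_mem_closure (Z : Matrix (Fin 3) (Fin 3) ℤ) (hdet : Z.det = 1)
    (α : ℝ) (hα : 1 < α) (a : Fin 3 → ℝ)
    (hZa : (Z.map ((↑) : ℤ → ℝ)).mulVec a = α • a)
    (β : ℂ) (hβ : β.im ≠ 0) (b : Fin 3 → ℂ)
    (hZb : (Z.map ((↑) : ℤ → ℂ)).mulVec b = β • b) {g : Equiv.Perm InoueHC}
    (hg : g ∈ Subgroup.closure {inoueDilat α β hα hβ, inoueTransl (a 0) (b 0),
        inoueTransl (a 1) (b 1), inoueTransl (a 2) (b 2)}) :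
    ∃ n v, IsInoueAffine α a β b n v g := by
  have hα0 : α ≠ 0 := (lt_trans one_pos hα).ne'
  have hαC : (α : ℂ) ≠ 0 := by exact_mod_cast hα0
  have hβ0 : β ≠ 0 := fun h => hβ (by rw [h, Complex.zero_im])
  have keyA := eigenvector_zpow_mul_dotProduct Z hdet hα0 hZa
  have keyB := eigenvector_zpow_mul_dotProduct Z hdet hβ0 hZb
  have transl : ∀ i, ∃ n v, IsInoueAffine α a β b n v (inoueTransl (a i) (b i)) := by
    intro i
    refine ⟨0, Pi.single i 1, fun p => ?_⟩
    simp [inoueTransl, dotProduct, Pi.single_apply]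
  induction hg using Subgroup.closure_induction with
  | mem x hx =>
    simp only [Set.mem_insert_iff, Set.mem_singleton_iff] at hx
    rcases hx with rfl | rfl | rfl | rfl
    · refine ⟨1, 0, fun p => ?_⟩
      simp [inoueDilat, dotProduct]
    · exact transl 0
    · exact transl 1
    · exact transl 2
  | one =>
    refine ⟨0, 0, fun p => ?_⟩
    simp [dotProduct]
  | mul x y _ _ hx hy =>
    obtain ⟨n, v, hx⟩ := hx
    obtain ⟨m, u, hy⟩ := hy
    refine ⟨n + m, v + u ᵥ* Z ^ n, fun p => ?_⟩
    have hA : (fun i => ((v + u ᵥ* Z ^ n) i : ℝ)) ⬝ᵥ a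
        = (fun i => (v i : ℝ)) ⬝ᵥ a + α ^ n * ((fun i => (u i : ℝ)) ⬝ᵥ a) := by
      rw [keyA, ← add_dotProduct]
      congr 1
      ext i
      simp
    have hB : (fun i => ((v + u ᵥ* Z ^ n) i : ℂ)) ⬝ᵥ b
        = (fun i => (v i : ℂ)) ⬝ᵥ b + β ^ n * ((fun i => (u i : ℂ)) ⬝ᵥ b) := by
      rw [keyB, ← add_dotProduct]
      congr 1
      ext i
      simp
    rw [Equiv.Perm.mul_apply, (hx _).1, (hx _).2, (hy _).1, (hy _).2, hA, hB,
      zpow_add₀ hαC, zpow_add₀ hβ0]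
    push_cast
    constructor <;> ring
  | inv x _ hx =>
    obtain ⟨n, v, hx⟩ := hx
    refine ⟨-n, -(v ᵥ* Z ^ (-n)), fun p => ?_⟩
    have hA : (fun i => ((-(v ᵥ* Z ^ (-n))) i : ℝ)) ⬝ᵥ a
        = -(α ^ (-n) * ((fun i => (v i : ℝ)) ⬝ᵥ a)) := by
      rw [keyA, ← neg_dotProduct]
      congr 1
      ext i
      simp
    have hB : (fun i => ((-(v ᵥ* Z ^ (-n))) i : ℂ)) ⬝ᵥ b
        = -(β ^ (-n) * ((fun i => (v i : ℂ)) ⬝ᵥ b)) := by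
      rw [keyB, ← neg_dotProduct]
      congr 1
      ext i
      simp
    obtain ⟨h1, h2⟩ := hx (x⁻¹ p)
    rw [← Equiv.Perm.mul_apply, mul_inv_cancel, Equiv.Perm.one_apply] at h1 h2
    rw [hA, hB, h1, h2, _root_.zpow_neg, _root_.zpow_neg, _root_.zpow_neg]
    have := zpow_ne_zero n hαC
    have := zpow_ne_zero n hβ0
    push_cast
    constructor <;> field_simp <;> ring

/-- A real vector orthogonal to the real eigenvector `a` and to the non-real eigenvector `b`
vanishes. -/
theorem eq_zero_of_dotProduct_eigenvectors (Z : Matrix (Fin 3) (Fin 3) ℤ)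
    {α : ℝ} {a : Fin 3 → ℝ} (ha : a ≠ 0)
    (hZa : (Z.map ((↑) : ℤ → ℝ)).mulVec a = α • a)
    {β : ℂ} (hβ : β.im ≠ 0) {b : Fin 3 → ℂ} (hb : b ≠ 0)
    (hZb : (Z.map ((↑) : ℤ → ℂ)).mulVec b = β • b) (x : Fin 3 → ℝ)
    (hxa : x ⬝ᵥ a = 0) (hxb : (fun i => (x i : ℂ)) ⬝ᵥ b = 0) : x = 0 := by
  set A : Matrix (Fin 3) (Fin 3) ℂ := Z.map ((↑) : ℤ → ℂ) with hA
  let μ : Fin 3 → ℂ := ![(α : ℂ), β, starRingEnd ℂ β]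
  let e : Fin 3 → Fin 3 → ℂ :=
    ![fun i => (a i : ℂ), b, fun i => starRingEnd ℂ (b i)]
  have h0 : A.mulVec (fun i => (a i : ℂ)) = (α : ℂ) • fun i => (a i : ℂ) := by
    ext i
    have := congrArg (Complex.ofReal) (congrFun hZa i)
    simpa [hA, Matrix.mulVec, dotProduct] using this
  have h2 : A.mulVec (fun i => starRingEnd ℂ (b i))
      = starRingEnd ℂ β • fun i => starRingEnd ℂ (b i) := by
    ext i
    have := congrArg (starRingEnd ℂ) (congrFun hZb i)
    simpa [hA, Matrix.mulVec, dotProduct] using this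
  have hμ : Function.Injective μ := by
    have him : ∀ i, (μ i).im = ![0, β.im, -β.im] i := by
      intro i
      fin_cases i <;> simp [μ]
    have hne : β.im ≠ -β.im := fun h => hβ (by linarith)
    intro i j hij
    have him' := congrArg Complex.im hij
    rw [him, him] at him'
    clear_value μ
    fin_cases i <;> fin_cases j <;> simp at him' ⊢ <;> grind
  have he : ∀ i, Module.End.HasEigenvector (Matrix.toLin' A) (μ i) (e i) := by
    intro i
    rw [Module.End.hasEigenvector_iff, Module.End.mem_eigenspace_iff, Matrix.toLin'_apply]
    fin_cases i
    · refine ⟨h0, fun h => ha ?_⟩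
      ext i
      simpa [e] using congrFun h i
    · exact ⟨hZb, hb⟩
    · refine ⟨h2, fun h => hb ?_⟩
      ext i
      simpa [e] using congrFun h i
  have hli : LinearIndependent ℂ e :=
    Module.End.eigenvectors_linearIndependent' _ μ hμ e he
  have hunit : IsUnit (Matrix.of e) := Matrix.linearIndependent_rows_iff_isUnit.mp hli
  have hker : (Matrix.of e).mulVec (fun i => (x i : ℂ)) = 0 := by
    ext i
    rw [Matrix.mulVec, dotProduct_comm]
    fin_cases i
    · have := congrArg Complex.ofReal hxa
      simpa [e, dotProduct] using this
    · exact hxb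
    · have := congrArg (starRingEnd ℂ) hxb
      simpa [e, dotProduct] using this
  have hx := Matrix.mulVec_injective_of_isUnit hunit (hker.trans (Matrix.mulVec_zero _).symm)
  ext i
  simpa using congrFun hx i

/-- The lattice of translation vectors `(v ⬝ a, v ⬝ b)` is discrete. -/
theorem finite_dotProduct_eigenvectors_bounded (Z : Matrix (Fin 3) (Fin 3) ℤ)
    {α : ℝ} {a : Fin 3 → ℝ} (ha : a ≠ 0)
    (hZa : (Z.map ((↑) : ℤ → ℝ)).mulVec a = α • a)
    {β : ℂ} (hβ : β.im ≠ 0) {b : Fin 3 → ℂ} (hb : b ≠ 0)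
    (hZb : (Z.map ((↑) : ℤ → ℂ)).mulVec b = β • b) (r s : ℝ) :
    {v : Fin 3 → ℤ | |(fun i => (v i : ℝ)) ⬝ᵥ a| ≤ r ∧
      ‖(fun i => (v i : ℂ)) ⬝ᵥ b‖ ≤ s}.Finite := by
  let f : (Fin 3 → ℝ) →ₗ[ℝ] ℝ × ℂ :=
    { toFun x := (x ⬝ᵥ a, (fun i => (x i : ℂ)) ⬝ᵥ b)
      map_add' x y := by
        ext1
        · simp [dotProduct, add_mul, Finset.sum_add_distrib]
        · simp [dotProduct, add_mul, Finset.sum_add_distrib]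
      map_smul' c x := by
        ext1
        · simp [dotProduct, mul_assoc, Finset.mul_sum]
        · simp [dotProduct, mul_assoc, Finset.mul_sum] }
  have hf : LinearMap.ker f = ⊥ := by
    rw [LinearMap.ker_eq_bot']
    intro x hx
    exact eq_zero_of_dotProduct_eigenvectors Z ha hZa hβ hb hZb x
      (congrArg Prod.fst hx) (congrArg Prod.snd hx)
  obtain ⟨C, -, hC⟩ := f.exists_antilipschitzWith hf
  obtain ⟨N, hN⟩ := exists_nat_ge ((C : ℝ) * max r s)
  refine (Set.finite_Icc (fun _ : Fin 3 => -(N : ℤ)) (fun _ => (N : ℤ))).subset ?_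
  rintro v ⟨hr, hs⟩
  have hv : ∀ i, |v i| ≤ (N : ℤ) := by
    intro i
    have h1 : ‖(fun i => (v i : ℝ))‖ ≤ C * ‖f (fun i => (v i : ℝ))‖ := by
      simpa using hC.le_mul_dist (fun i => (v i : ℝ)) 0
    have h2 : ‖f (fun i => (v i : ℝ))‖ ≤ max r s := by
      rw [Prod.norm_def]
      refine max_le_max hr ?_
      simpa [f] using hs
    have h3 := norm_le_pi_norm (fun i => (v i : ℝ)) i
    rw [Real.norm_eq_abs] at h3
    have h4 : |(v i : ℝ)| ≤ N :=
      h3.trans (h1.trans ((mul_le_mul_of_nonneg_left h2 C.2).trans hN))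
    exact_mod_cast h4
  exact ⟨fun i => (abs_le.mp (hv i)).1, fun i => (abs_le.mp (hv i)).2⟩

/-- A compact subset of `ℍ × ℂ` has bounded coordinates and height bounded away from `0`. -/
theorem InoueHC.exists_bound_of_isCompact {K : Set InoueHC} (hK : IsCompact K) :
    ∃ R : ℝ, ∀ p ∈ K, ‖p.1.1‖ ≤ R ∧ ‖p.2‖ ≤ R ∧ (p.1.1.im)⁻¹ ≤ R := by
  have hc : Continuous fun p : InoueHC => (p.1.1, p.2, (p.1.1.im)⁻¹) := by
    have h1 : Continuous fun p : InoueHC => p.1.1 := continuous_subtype_val.comp continuous_fst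
    exact h1.prodMk (continuous_snd.prodMk
      ((Complex.continuous_im.comp h1).inv₀ fun p => p.1.2.ne'))
  obtain ⟨R, hR⟩ := hK.exists_bound_of_continuousOn hc.continuousOn
  refine ⟨R, fun p hp => ?_⟩
  have h := hR p hp
  simp only [Prod.norm_def, max_le_iff] at h
  exact ⟨h.1, h.2.1, (le_abs_self _).trans h.2.2⟩

/-- In the Inoue setup, the subgroup `G_Z` of bijections of `ℍ × ℂ`
generated by `g₀, g₁, g₂, g₃` acts freely (no element other than the identity has a fixed
point) and properly discontinuously: for all compact `K, L ⊆ ℍ × ℂ`, the set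
`{g ∈ G_Z : g(K) ∩ L ≠ ∅}` is finite. -/
theorem inoue_action_free_properly_discontinuous
    (Z : Matrix (Fin 3) (Fin 3) ℤ) (hdet : Z.det = 1)
    (α : ℝ) (hα : 1 < α) (a : Fin 3 → ℝ) (ha : a ≠ 0)
    (hZa : (Z.map ((↑) : ℤ → ℝ)).mulVec a = α • a)
    (β : ℂ) (hβ : β.im ≠ 0) (b : Fin 3 → ℂ) (hb : b ≠ 0)
    (hZb : (Z.map ((↑) : ℤ → ℂ)).mulVec b = β • b) :
    (∀ g ∈ Subgroup.closure {inoueDilat α β hα hβ, inoueTransl (a 0) (b 0),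
        inoueTransl (a 1) (b 1), inoueTransl (a 2) (b 2)},
      g ≠ 1 → ∀ p : InoueHC, g p ≠ p) ∧
    (∀ K L : Set InoueHC, IsCompact K → IsCompact L →
      {g : Equiv.Perm InoueHC |
        g ∈ Subgroup.closure {inoueDilat α β hα hβ, inoueTransl (a 0) (b 0),
          inoueTransl (a 1) (b 1), inoueTransl (a 2) (b 2)} ∧
        (⇑g '' K ∩ L).Nonempty}.Finite) := by
  have normal := fun g hg =>
    exists_isInoueAffine_of_mem_closure Z hdet α hα a hZa β hβ b hZb (g := g) hg
  have him : ∀ {n v g}, IsInoueAffine α a β b n v g → ∀ p,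
      (g p).1.1.im = α ^ n * p.1.1.im := by
    intro n v g hg p
    rw [(hg p).1, ← Complex.ofReal_zpow, Complex.add_im, Complex.im_ofReal_mul,
      Complex.ofReal_im, add_zero]
  refine ⟨fun g hg hne p hp => hne ?_, fun K L hK hL => ?_⟩
  · obtain ⟨n, v, h⟩ := normal g hg
    have h1 := him h p
    rw [hp, eq_comm, mul_eq_right₀ p.1.2.ne'] at h1
    have hn : n = 0 := by
      rwa [zpow_eq_one_iff_right₀ (by linarith) hα.ne'] at h1
    subst hn
    obtain ⟨h2, h3⟩ := h p
    rw [hp, zpow_zero, one_mul, left_eq_add] at h2 h3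
    ext1 q
    obtain ⟨h4, h5⟩ := h q
    rw [h2, zpow_zero, one_mul, add_zero] at h4
    rw [h3, zpow_zero, one_mul, add_zero] at h5
    exact Prod.ext (Subtype.ext h4) h5
  obtain ⟨R, hR⟩ := InoueHC.exists_bound_of_isCompact (hK.union hL)
  obtain ⟨N, hN⟩ := pow_unbounded_of_one_lt (R * R) hα
  let V (n : ℤ) : Set (Fin 3 → ℤ) := {v | |(fun i => (v i : ℝ)) ⬝ᵥ a| ≤ R + ‖(α : ℂ) ^ n‖ * R ∧
    ‖(fun i => (v i : ℂ)) ⬝ᵥ b‖ ≤ R + ‖β ^ n‖ * R}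
  have hfin : (⋃ n ∈ Set.Icc (-(N : ℤ)) N, ⋃ v ∈ V n,
      {g | IsInoueAffine α a β b n v g}).Finite :=
    (Set.finite_Icc _ _).biUnion fun n _ =>
      (finite_dotProduct_eigenvectors_bounded Z ha hZa hβ hb hZb _ _).biUnion fun v _ =>
        Set.Subsingleton.finite fun _ hg _ hh => IsInoueAffine.ext hg hh
  refine hfin.subset ?_
  rintro g ⟨hg, _, ⟨p, hpK, rfl⟩, hpL⟩
  obtain ⟨n, v, h⟩ := normal g hg
  obtain ⟨hp1, hp2, hp3⟩ := hR p (Or.inl hpK)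
  obtain ⟨hq1, hq2, hq3⟩ := hR (g p) (Or.inr hpL)
  have hn := him h p
  have hp0 := p.1.2
  have hq0 := (g p).1.2
  have hpim : p.1.1.im ≤ R := (Complex.im_le_norm _).trans hp1
  have hqim : (g p).1.1.im ≤ R := (Complex.im_le_norm _).trans hq1
  have hR0 : 0 ≤ R := hp0.le.trans hpim
  have hup : α ^ n ≤ R * R := by
    rw [show α ^ n = (g p).1.1.im * (p.1.1.im)⁻¹ by rw [hn]; field_simp]
    exact mul_le_mul hqim hp3 (inv_pos.mpr hp0).le hR0
  have hdown : α ^ (-n) ≤ R * R := by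
    rw [show α ^ (-n) = p.1.1.im * ((g p).1.1.im)⁻¹ by rw [hn, zpow_neg]; field_simp]
    exact mul_le_mul hpim hq3 (inv_pos.mpr hq0).le hR0
  have hlt : ∀ m : ℤ, α ^ m ≤ R * R → m < N := by
    intro m hm
    rw [← zpow_lt_zpow_iff_right₀ hα, zpow_natCast]
    exact hm.trans_lt hN
  have hn1 := hlt n hup
  have hn2 := hlt (-n) hdown
  simp only [Set.mem_iUnion]
  refine ⟨n, ⟨by linarith, hn1.le⟩, v, ⟨?_, ?_⟩, h⟩
  · rw [← Real.norm_eq_abs, ← Complex.norm_real, ← sub_eq_of_eq_add' (h p).1]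
    refine (norm_sub_le _ _).trans (add_le_add hq1 ?_)
    rw [norm_mul]
    exact mul_le_mul_of_nonneg_left hp1 (norm_nonneg _)
  · rw [← sub_eq_of_eq_add' (h p).2]
    refine (norm_sub_le _ _).trans (add_le_add hq2 ?_)
    rw [norm_mul]
    exact mul_le_mul_of_nonneg_left hp2 (norm_nonneg _)

end
end

section
/- In the Inoue setup, suppose the three vectors (aᵢ, Re bᵢ, Im bᵢ) ∈ ℝ³, i = 1,2,3, are linearly independent over ℝ, and let G be the subgroup of bijections of ℍ × ℂ generated by the translations g₁, g₂, g₃. Then the orbit space (ℍ × ℂ)/G, with the quotient topology, is homeomorphic to (ℝ/ℤ)³ × (0,∞). -/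
noncomputable section

/-- If the generators `g i` become the integral unit translations of `ℝ^ι` in the coordinates
`h : X ≃ₜ (ι → ℝ) × Y`, the orbit relation of the group they generate is congruence of the
`ℝ^ι`-coordinates modulo `ℤ^ι` together with equality of the `Y`-coordinates. -/
lemma orbitRel_closure_range_iff {ι X Y : Type*} [Fintype ι] [DecidableEq ι]
    (h : X ≃ (ι → ℝ) × Y) (g : ι → Equiv.Perm X)
    (hg : ∀ i p, h (g i p) = ((h p).1 + Pi.single i 1, (h p).2)) (p q : X) :
    MulAction.orbitRel (Subgroup.closure (Set.range g)) X p q ↔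
      (fun i => ((h p).1 i : AddCircle (1 : ℝ))) = (fun i => ((h q).1 i : AddCircle (1 : ℝ))) ∧
        (h p).2 = (h q).2 := by
  rw [MulAction.orbitRel_apply, MulAction.mem_orbit_iff]
  constructor
  · rintro ⟨⟨σ, hσ⟩, rfl⟩
    change (fun i => ((h (σ q)).1 i : AddCircle (1 : ℝ))) = _ ∧ (h (σ q)).2 = _
    induction hσ using Subgroup.closure_induction generalizing q with
    | mem σ hσ =>
      obtain ⟨j, rfl⟩ := hσ
      refine ⟨funext fun i => ?_, by rw [hg]⟩
      rw [hg]
      obtain rfl | hij := eq_or_ne i j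
      · simp
      · simp [hij]
    | one => exact ⟨rfl, rfl⟩
    | mul σ τ _ _ hσ hτ =>
      exact ⟨(hσ (τ q)).1.trans (hτ q).1, (hσ (τ q)).2.trans (hτ q).2⟩
    | inv σ _ hσ =>
      have := hσ (σ⁻¹ q)
      rw [← Equiv.Perm.mul_apply, mul_inv_cancel, Equiv.Perm.one_apply] at this
      exact ⟨this.1.symm, this.2.symm⟩
  · rintro ⟨h₁, h₂⟩
    have hz : ∀ i, ∃ n : ℤ, (n : ℝ) = (h p).1 i - (h q).1 i := fun i => by
      have := congrFun h₁ i
      rw [← sub_eq_zero, ← AddCircle.coe_sub, AddCircle.coe_eq_zero_iff] at this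
      simpa using this
    choose n hn using hz
    have hpow : ∀ (i : ι) (m : ℤ) (x : X),
        h ((g i ^ m) x) = ((h x).1 + Pi.single i (m : ℝ), (h x).2) := fun i m => by
      induction m with
      | zero => simp
      | succ m ih =>
        intro x
        rw [zpow_add_one, Equiv.Perm.mul_apply, ih, hg]
        simp [Pi.single_add, add_assoc, add_comm]
      | pred m ih =>
        intro x
        have hx := hg i ((g i)⁻¹ x)
        rw [← Equiv.Perm.mul_apply, mul_inv_cancel, Equiv.Perm.one_apply] at hx
        rw [zpow_sub_one, Equiv.Perm.mul_apply, ih, hx]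
        simp [Pi.single_sub, add_assoc]
    have hsum : ∀ s : Finset ι, ∃ σ ∈ Subgroup.closure (Set.range g), ∀ x,
        h (σ x) = ((h x).1 + ∑ i ∈ s, Pi.single i (n i : ℝ), (h x).2) := fun s => by
      induction s using Finset.induction_on with
      | empty => exact ⟨1, one_mem _, by simp⟩
      | insert i s his ih =>
        obtain ⟨σ, hσ, hσx⟩ := ih
        refine ⟨g i ^ n i * σ,
          mul_mem (zpow_mem (Subgroup.subset_closure (Set.mem_range_self i)) _) hσ, fun x => ?_⟩
        rw [Equiv.Perm.mul_apply, hpow, hσx, Finset.sum_insert his]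
        simp [add_assoc, add_comm]
    obtain ⟨σ, hσ, hσx⟩ := hsum Finset.univ
    refine ⟨⟨σ, hσ⟩, h.injective ?_⟩
    change h (σ q) = h p
    rw [hσx, Finset.univ_sum_single]
    refine Prod.ext (funext fun i => ?_) h₂.symm
    simp [hn]

/-- If the generators `g i` become the integral unit translations of `ℝ^ι` in the coordinates
`h : X ≃ₜ (ι → ℝ) × Y`, the orbit space is the product of a torus with `Y`. -/
lemma nonempty_orbitSpace_homeomorph_torus_prod {ι X Y : Type*} [Fintype ι] [DecidableEq ι]
    [TopologicalSpace X] [TopologicalSpace Y] (h : X ≃ₜ (ι → ℝ) × Y) (g : ι → Equiv.Perm X)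
    (hg : ∀ i p, h (g i p) = ((h p).1 + Pi.single i 1, (h p).2)) :
    Nonempty (Quotient (MulAction.orbitRel (Subgroup.closure (Set.range g)) X) ≃ₜ
      (ι → AddCircle (1 : ℝ)) × Y) := by
  let f : X → (ι → AddCircle (1 : ℝ)) × Y := fun p => (fun i => ((h p).1 i), (h p).2)
  have hf : IsOpenQuotientMap f :=
    ((IsOpenQuotientMap.piMap fun _ => QuotientAddGroup.isOpenQuotientMap_mk).prodMap
      .id).comp h.isOpenQuotientMap
  have hrel : MulAction.orbitRel (Subgroup.closure (Set.range g)) X = Setoid.ker f :=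
    Setoid.ext fun p q => (orbitRel_closure_range_iff h.toEquiv g hg p q).trans
      (Prod.ext_iff (x := f p) (y := f q)).symm
  rw [hrel]
  exact ⟨Topology.IsQuotientMap.homeomorph (f := ⟨f, hf.continuous⟩) hf.isQuotientMap⟩

/-- The homeomorphism `(w, z) ↦ ((Re w, Re z, Im z), Im w)`. -/
def inoueRealCoords : InoueHC ≃ₜ (Fin 3 → ℝ) × Set.Ioi (0 : ℝ) where
  toFun p := (![p.1.1.re, p.2.re, p.2.im], ⟨p.1.1.im, p.1.2⟩)
  invFun x := (⟨⟨x.1 0, x.2.1⟩, x.2.2⟩, ⟨x.1 1, x.1 2⟩)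
  left_inv p := rfl
  right_inv x := Prod.ext (funext fun i => by fin_cases i <;> rfl) rfl
  continuous_toFun := by fun_prop
  continuous_invFun := by
    have hmk : ∀ {f g : (Fin 3 → ℝ) × Set.Ioi (0 : ℝ) → ℝ}, Continuous f → Continuous g →
        Continuous fun x => (⟨f x, g x⟩ : ℂ) := fun hf hg =>
      Complex.equivRealProdCLM.symm.continuous.comp (hf.prodMk hg)
    exact ((hmk (by fun_prop) (by fun_prop)).subtype_mk _).prodMk
      (hmk (by fun_prop) (by fun_prop))

lemma inoueRealCoords_inoueTransl (c : ℝ) (d : ℂ) (p : InoueHC) :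
    inoueRealCoords (inoueTransl c d p) =
      ((inoueRealCoords p).1 + ![c, d.re, d.im], (inoueRealCoords p).2) := by
  have happly : ∀ q : InoueHC,
      inoueRealCoords q = (![q.1.1.re, q.2.re, q.2.im], ⟨q.1.1.im, q.1.2⟩) := fun _ => rfl
  rw [happly, happly]
  refine Prod.ext (funext fun i => ?_) (Subtype.ext ?_)
  · fin_cases i <;> simp [inoueTransl]
  · simp [inoueTransl]

/-- In the Inoue setup, if the three vectors `(aᵢ, Re bᵢ, Im bᵢ) ∈ ℝ³` are
linearly independent over `ℝ`, and `G ≤ Perm(ℍ × ℂ)` is the subgroup generated by the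
translations `g₁, g₂, g₃`, then the orbit space `(ℍ × ℂ)/G`, with the quotient topology, is
homeomorphic to `(ℝ/ℤ)³ × (0,∞)`. -/
theorem inoue_intermediate_quotient_homeomorph
    (Z : Matrix (Fin 3) (Fin 3) ℤ) (hdet : Z.det = 1)
    (α : ℝ) (hα : 1 < α) (a : Fin 3 → ℝ) (ha : a ≠ 0)
    (hZa : (Z.map ((↑) : ℤ → ℝ)).mulVec a = α • a)
    (β : ℂ) (hβ : β.im ≠ 0) (b : Fin 3 → ℂ) (hb : b ≠ 0)
    (hZb : (Z.map ((↑) : ℤ → ℂ)).mulVec b = β • b)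
    (hind : LinearIndependent ℝ (fun i : Fin 3 => ![a i, (b i).re, (b i).im])) :
    Nonempty
      (Quotient (MulAction.orbitRel
          (↥(Subgroup.closure
            {inoueTransl (a 0) (b 0), inoueTransl (a 1) (b 1), inoueTransl (a 2) (b 2)}))
          InoueHC) ≃ₜ
        (Fin 3 → AddCircle (1 : ℝ)) × ↥(Set.Ioi (0 : ℝ))) := by
  let B := basisOfLinearIndependentOfCardEqFinrank hind (by simp)
  have hB : ∀ i, B i = ![a i, (b i).re, (b i).im] := fun i => by simp [B]
  have key := nonempty_orbitSpace_homeomorph_torus_prod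
    (inoueRealCoords.trans (B.equivFunL.toHomeomorph.prodCongr (Homeomorph.refl _)))
    (fun i => inoueTransl (a i) (b i)) (fun i p => by
      refine Prod.ext ?_ ?_
      · change B.equivFun (inoueRealCoords (inoueTransl (a i) (b i) p)).1 =
          B.equivFun (inoueRealCoords p).1 + Pi.single i 1
        rw [inoueRealCoords_inoueTransl, ← hB, map_add]
        congr 1
        ext j
        simp [Pi.single_apply, eq_comm]
      · change (inoueRealCoords (inoueTransl (a i) (b i) p)).2 = (inoueRealCoords p).2
        rw [inoueRealCoords_inoueTransl])
  have hrange : Set.range (fun i => inoueTransl (a i) (b i)) =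
      {inoueTransl (a 0) (b 0), inoueTransl (a 1) (b 1), inoueTransl (a 2) (b 2)} := by
    ext σ
    simp [Fin.exists_fin_succ, eq_comm]
  rwa [hrange] at key

end
end

section
/- In the Inoue setup, let G_Z be the subgroup of bijections of ℍ × ℂ generated by g₀, g₁, g₂, g₃. Then the orbit space S_Z = (ℍ × ℂ)/G_Z, equipped with the quotient topology, is a compact Hausdorff topological space. -/
noncomputable section

open Set

theorem linearIndependent_eigenvector_pairs
    (Z : Matrix (Fin 3) (Fin 3) ℤ) (α : ℝ) (a : Fin 3 → ℝ) (ha : a ≠ 0)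
    (hZa : (Z.map ((↑) : ℤ → ℝ)).mulVec a = α • a)
    (β : ℂ) (hβ : β.im ≠ 0) (b : Fin 3 → ℂ) (hb : b ≠ 0)
    (hZb : (Z.map ((↑) : ℤ → ℂ)).mulVec b = β • b) :
    LinearIndependent ℝ (fun i => (a i, b i)) := by
  set P : Matrix (Fin 3) (Fin 3) ℂ :=
    ![fun i => (a i : ℂ), b, fun i => (starRingEnd ℂ) (b i)] with hP
  set μ : Fin 3 → ℂ := ![(α : ℂ), β, (starRingEnd ℂ) β] with hμ
  have hμ_inj : Function.Injective μ := by
    have h₁ : (α : ℂ) ≠ β := fun h => hβ (by rw [← h, Complex.ofReal_im])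
    have h₂ : (α : ℂ) ≠ (starRingEnd ℂ) β := fun h => hβ (by
      have := congrArg Complex.im h
      simpa using this.symm)
    have h₃ : β ≠ (starRingEnd ℂ) β := fun h => hβ (by
      have := congrArg Complex.im h
      simp only [Complex.conj_im] at this
      linarith)
    intro i j hij
    fin_cases i <;> fin_cases j <;> simp_all [eq_comm]
  have hvec : ∀ i, Module.End.HasEigenvector
      (Matrix.toLin' (Z.map ((↑) : ℤ → ℂ))) (μ i) (P i) := by
    intro i
    rw [Module.End.hasEigenvector_iff, Module.End.mem_eigenspace_iff, Matrix.toLin'_apply]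
    fin_cases i
    · constructor
      · ext j
        have := congrArg (fun x : ℝ => (x : ℂ)) (congrFun hZa j)
        simpa [hP, hμ, Matrix.mulVec, dotProduct] using this
      · intro h
        exact ha (funext fun j => by simpa [hP] using congrFun h j)
    · exact ⟨hZb, hb⟩
    · constructor
      · ext j
        have := congrArg (starRingEnd ℂ) (congrFun hZb j)
        simpa [hP, hμ, Matrix.mulVec, dotProduct] using this
      · intro h
        exact hb (funext fun j => by simpa [hP] using congrFun h j)
  have hli : LinearIndependent ℂ P :=
    Module.End.eigenvectors_linearIndependent' _ μ hμ_inj P hvec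
  have hunit : IsUnit P := Matrix.linearIndependent_rows_iff_isUnit.1 hli
  rw [Fintype.linearIndependent_iff]
  intro c hc
  have hc₁ : ∑ i, c i * a i = 0 := by simpa [Prod.fst_sum] using congrArg Prod.fst hc
  have hc₂ : ∑ i, (c i : ℂ) * b i = 0 := by simpa [Prod.snd_sum] using congrArg Prod.snd hc
  have hPc : P.mulVec (fun i => (c i : ℂ)) = 0 := by
    ext j
    fin_cases j
    · have := congrArg (fun x : ℝ => (x : ℂ)) hc₁
      simpa [hP, Matrix.mulVec, dotProduct, mul_comm] using this
    · simpa [hP, Matrix.mulVec, dotProduct, mul_comm] using hc₂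
    · have := congrArg (starRingEnd ℂ) hc₂
      simpa [hP, Matrix.mulVec, dotProduct, mul_comm] using this
  have := Matrix.mulVec_injective_of_isUnit hunit (hPc.trans (Matrix.mulVec_zero P).symm)
  intro i
  simpa using congrFun this i

/-- The period lattice spanned by the pairs `(aᵢ, bᵢ)`. -/
abbrev inoueLattice (a : Fin 3 → ℝ) (b : Fin 3 → ℂ) : Submodule ℤ (ℝ × ℂ) :=
  Submodule.span ℤ (range fun i => (a i, b i))

theorem inoueLattice_mul_mem_of_mulVec {a : Fin 3 → ℝ} {b : Fin 3 → ℂ}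
    (W : Matrix (Fin 3) (Fin 3) ℤ) {γ : ℝ} {δ : ℂ}
    (hWa : (W.map ((↑) : ℤ → ℝ)).mulVec a = γ • a)
    (hWb : (W.map ((↑) : ℤ → ℂ)).mulVec b = δ • b)
    {x : ℝ × ℂ} (hx : x ∈ inoueLattice a b) : (γ, δ) * x ∈ inoueLattice a b := by
  induction hx using Submodule.span_induction with
  | mem x hx =>
    obtain ⟨j, rfl⟩ := hx
    have : (γ, δ) * (a j, b j) = ∑ i, W j i • (a i, b i) := by
      ext1
      · simpa [Matrix.mulVec, dotProduct, Prod.fst_sum] using (congrFun hWa j).symm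
      · simpa [Matrix.mulVec, dotProduct, Prod.snd_sum] using (congrFun hWb j).symm
    simp only [this]
    exact Submodule.sum_mem _ fun i _ => Submodule.smul_mem _ _ (Submodule.subset_span ⟨i, rfl⟩)
  | zero => simp
  | add x y _ _ hx hy => rw [mul_add]; exact add_mem hx hy
  | smul n x _ hx => rw [mul_smul_comm]; exact Submodule.smul_mem _ _ hx

theorem mulVec_inv_eq_inv_smul {K : Type*} [Field K] {Z : Matrix (Fin 3) (Fin 3) ℤ}
    (hdet : Z.det = 1) {γ : K} (hγ : γ ≠ 0) {v : Fin 3 → K}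
    (hv : (Z.map ((↑) : ℤ → K)).mulVec v = γ • v) :
    ((Z⁻¹).map ((↑) : ℤ → K)).mulVec v = γ⁻¹ • v := by
  have hmul : (Z⁻¹).map ((↑) : ℤ → K) * Z.map ((↑) : ℤ → K) = 1 := by
    have := congrArg (fun M => M.map (Int.castRingHom K))
      (Matrix.nonsing_inv_mul Z (by rw [hdet]; exact isUnit_one))
    rw [Matrix.map_mul] at this
    simpa using this
  have := congrArg (((Z⁻¹).map ((↑) : ℤ → K)).mulVec) hv
  rw [Matrix.mulVec_mulVec, hmul, Matrix.one_mulVec, Matrix.mulVec_smul] at this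
  rw [eq_inv_smul_iff₀ hγ, ← this]

theorem inoueLattice_zpow_mul_mem {Z : Matrix (Fin 3) (Fin 3) ℤ} (hdet : Z.det = 1)
    {α : ℝ} (hα : α ≠ 0) {a : Fin 3 → ℝ}
    (hZa : (Z.map ((↑) : ℤ → ℝ)).mulVec a = α • a)
    {β : ℂ} (hβ : β ≠ 0) {b : Fin 3 → ℂ}
    (hZb : (Z.map ((↑) : ℤ → ℂ)).mulVec b = β • b)
    (n : ℤ) {x : ℝ × ℂ} (hx : x ∈ inoueLattice a b) :
    (α ^ n, β ^ n) * x ∈ inoueLattice a b := by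
  induction n with
  | zero => simpa [← Prod.one_eq_mk] using hx
  | succ n ih =>
    rw [zpow_add_one₀ hα, zpow_add_one₀ hβ, mul_comm _ α, mul_comm _ β,
      ← Prod.mk_mul_mk, mul_assoc]
    exact inoueLattice_mul_mem_of_mulVec Z hZa hZb ih
  | pred n ih =>
    rw [zpow_sub_one₀ hα, zpow_sub_one₀ hβ, mul_comm _ α⁻¹, mul_comm _ β⁻¹,
      ← Prod.mk_mul_mk, mul_assoc]
    exact inoueLattice_mul_mem_of_mulVec Z⁻¹ (mulVec_inv_eq_inv_smul hdet hα hZa)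
      (mulVec_inv_eq_inv_smul hdet hβ hZb) ih

/-- The group generated by `g₀, g₁, g₂, g₃`. -/
abbrev inoueGroup (α : ℝ) (β : ℂ) (hα : 1 < α) (hβ : β.im ≠ 0) (a : Fin 3 → ℝ) (b : Fin 3 → ℂ) :
    Subgroup (Equiv.Perm InoueHC) :=
  Subgroup.closure {inoueDilat α β hα hβ, inoueTransl (a 0) (b 0),
    inoueTransl (a 1) (b 1), inoueTransl (a 2) (b 2)}

theorem inoueTransl_mem_inoueGroup {α : ℝ} {β : ℂ} {hα : 1 < α} {hβ : β.im ≠ 0}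
    {a : Fin 3 → ℝ} {b : Fin 3 → ℂ} {x : ℝ × ℂ} (hx : x ∈ inoueLattice a b) :
    inoueTransl x.1 x.2 ∈ inoueGroup α β hα hβ a b := by
  have hneg : ∀ y : ℝ × ℂ, inoueTransl (-y).1 (-y).2 = (inoueTransl y.1 y.2)⁻¹ := by
    intro y
    rw [eq_inv_iff_mul_eq_one]
    ext p <;> simp [inoueTransl]
  let S : AddSubgroup (ℝ × ℂ) :=
    { carrier := {x | inoueTransl x.1 x.2 ∈ inoueGroup α β hα hβ a b}
      add_mem' := by
        intro x y hx hy
        have : inoueTransl (x + y).1 (x + y).2 = inoueTransl x.1 x.2 * inoueTransl y.1 y.2 := by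
          ext p <;> simp [inoueTransl] <;> ring
        simpa only [mem_ofPred_eq, this] using mul_mem hx hy
      zero_mem' := by
        have : inoueTransl (0 : ℝ × ℂ).1 (0 : ℝ × ℂ).2 = 1 := by
          ext p <;> simp [inoueTransl]
        simpa only [mem_ofPred_eq, this] using one_mem _
      neg_mem' := by
        intro x hx
        simpa only [mem_ofPred_eq, hneg] using inv_mem hx }
  have hle : inoueLattice a b ≤ S.toIntSubmodule := by
    refine Submodule.span_le.2 ?_
    rintro _ ⟨i, rfl⟩
    refine Subgroup.subset_closure ?_
    fin_cases i <;> simp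
  exact hle hx

theorem inoueDilat_zpow_apply {α : ℝ} {β : ℂ} (hα : 1 < α) (hβ : β.im ≠ 0) (n : ℤ)
    (p : InoueHC) :
    (((inoueDilat α β hα hβ ^ n) p).1.1 : ℂ) = (α : ℂ) ^ n * p.1.1 ∧
      ((inoueDilat α β hα hβ ^ n) p).2 = β ^ n * p.2 := by
  have hα0 : (α : ℂ) ≠ 0 := by exact_mod_cast (one_pos.trans hα).ne'
  have hβ0 : β ≠ 0 := fun h => hβ (by rw [h, Complex.zero_im])
  induction n with
  | zero => simp
  | succ n ih =>
    rw [add_comm, zpow_one_add, zpow_one_add₀ hα0, zpow_one_add₀ hβ0, mul_assoc, mul_assoc,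
      ← ih.1, ← ih.2]
    exact ⟨rfl, rfl⟩
  | pred n ih =>
    rw [sub_eq_neg_add, zpow_add, zpow_add₀ hα0, zpow_add₀ hβ0, mul_assoc, mul_assoc,
      ← ih.1, ← ih.2, zpow_neg_one, zpow_neg_one, zpow_neg_one, ← Complex.ofReal_inv]
    exact ⟨rfl, rfl⟩

theorem exists_affine_of_mem_inoueGroup {Z : Matrix (Fin 3) (Fin 3) ℤ} (hdet : Z.det = 1)
    {α : ℝ} (hα : 1 < α) {a : Fin 3 → ℝ}
    (hZa : (Z.map ((↑) : ℤ → ℝ)).mulVec a = α • a)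
    {β : ℂ} (hβ : β.im ≠ 0) {b : Fin 3 → ℂ}
    (hZb : (Z.map ((↑) : ℤ → ℂ)).mulVec b = β • b)
    {g : Equiv.Perm InoueHC} (hg : g ∈ inoueGroup α β hα hβ a b) :
    ∃ n : ℤ, ∃ x ∈ inoueLattice a b, ∀ p : InoueHC,
      ((g p).1.1 : ℂ) = (α : ℂ) ^ n * p.1.1 + x.1 ∧ (g p).2 = β ^ n * p.2 + x.2 := by
  have hαr : α ≠ 0 := (one_pos.trans hα).ne'
  have hα0 : (α : ℂ) ≠ 0 := by exact_mod_cast hαr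
  have hβ0 : β ≠ 0 := fun h => hβ (by rw [h, Complex.zero_im])
  have htransl : ∀ i, ∃ n : ℤ, ∃ x ∈ inoueLattice a b, ∀ p : InoueHC,
      ((inoueTransl (a i) (b i) p).1.1 : ℂ) = (α : ℂ) ^ n * p.1.1 + x.1 ∧
        (inoueTransl (a i) (b i) p).2 = β ^ n * p.2 + x.2 := fun i =>
    ⟨0, (a i, b i), Submodule.subset_span ⟨i, rfl⟩, fun p => by simp [inoueTransl]⟩
  induction hg using Subgroup.closure_induction with
  | mem g hg =>
    rcases hg with rfl | rfl | rfl | rfl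
    · exact ⟨1, 0, zero_mem _, fun p => by simp [inoueDilat]⟩
    · exact htransl 0
    · exact htransl 1
    · exact htransl 2
  | one => exact ⟨0, 0, zero_mem _, fun p => by simp⟩
  | mul g h _ _ hg hh =>
    obtain ⟨n, x, hx, hgx⟩ := hg
    obtain ⟨m, y, hy, hhy⟩ := hh
    refine ⟨n + m, (α ^ n, β ^ n) * y + x,
      add_mem (inoueLattice_zpow_mul_mem hdet hαr hZa hβ0 hZb n hy) hx, fun p => ?_⟩
    rw [Equiv.Perm.mul_apply, (hgx _).1, (hgx _).2, (hhy _).1, (hhy _).2,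
      zpow_add₀ hα0, zpow_add₀ hβ0]
    constructor
    · simp; ring
    · simp; ring
  | inv g _ hg =>
    obtain ⟨n, x, hx, hgx⟩ := hg
    refine ⟨-n, (α ^ (-n), β ^ (-n)) * (-x),
      inoueLattice_zpow_mul_mem hdet hαr hZa hβ0 hZb _ (neg_mem hx), fun p => ?_⟩
    have h := hgx (g⁻¹ p)
    rw [show g (g⁻¹ p) = p from g.apply_symm_apply p] at h
    have hαn : (α : ℂ) ^ n ≠ 0 := zpow_ne_zero _ hα0
    have hβn : β ^ n ≠ 0 := zpow_ne_zero _ hβ0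
    constructor
    · rw [h.1]; simp; field_simp; ring
    · rw [h.2]; simp; field_simp; ring

theorem inoueGroup_orbitRel_iff {Z : Matrix (Fin 3) (Fin 3) ℤ} (hdet : Z.det = 1)
    {α : ℝ} (hα : 1 < α) {a : Fin 3 → ℝ}
    (hZa : (Z.map ((↑) : ℤ → ℝ)).mulVec a = α • a)
    {β : ℂ} (hβ : β.im ≠ 0) {b : Fin 3 → ℂ}
    (hZb : (Z.map ((↑) : ℤ → ℂ)).mulVec b = β • b) (q p : InoueHC) :
    MulAction.orbitRel (inoueGroup α β hα hβ a b) InoueHC q p ↔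
      ∃ n : ℤ, ∃ x ∈ inoueLattice a b,
        q.1.1 = (α : ℂ) ^ n * p.1.1 + x.1 ∧ q.2 = β ^ n * p.2 + x.2 := by
  rw [MulAction.orbitRel_apply, MulAction.mem_orbit_iff]
  constructor
  · rintro ⟨⟨g, hg⟩, rfl⟩
    obtain ⟨n, x, hx, h⟩ := exists_affine_of_mem_inoueGroup hdet hα hZa hβ hZb hg
    exact ⟨n, x, hx, h p⟩
  · rintro ⟨n, x, hx, h₁, h₂⟩
    refine ⟨⟨inoueTransl x.1 x.2 * inoueDilat α β hα hβ ^ n, mul_mem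
      (inoueTransl_mem_inoueGroup hx)
      (zpow_mem (Subgroup.subset_closure (mem_insert _ _)) _)⟩, ?_⟩
    have h := inoueDilat_zpow_apply hα hβ n p
    refine Prod.ext (Subtype.ext ?_) ?_
    · rw [h₁, ← h.1]; rfl
    · rw [h₂, ← h.2]; rfl

theorem continuousConstSMul_inoueGroup {Z : Matrix (Fin 3) (Fin 3) ℤ} (hdet : Z.det = 1)
    {α : ℝ} (hα : 1 < α) {a : Fin 3 → ℝ}
    (hZa : (Z.map ((↑) : ℤ → ℝ)).mulVec a = α • a)
    {β : ℂ} (hβ : β.im ≠ 0) {b : Fin 3 → ℂ}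
    (hZb : (Z.map ((↑) : ℤ → ℂ)).mulVec b = β • b) :
    ContinuousConstSMul (inoueGroup α β hα hβ a b) InoueHC := by
  refine ⟨fun g => ?_⟩
  obtain ⟨n, x, -, h⟩ := exists_affine_of_mem_inoueGroup hdet hα hZa hβ hZb g.2
  refine Continuous.prodMk (continuous_induced_rng.2 ?_) ?_
  · exact Continuous.congr (f := fun p : InoueHC => (α : ℂ) ^ n * p.1.1 + x.1) (by fun_prop)
      fun p => (h p).1.symm
  · exact Continuous.congr (f := fun p : InoueHC => β ^ n * p.2 + x.2) (by fun_prop)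
      fun p => (h p).2.symm

theorem isClosed_inoueGroup_orbitRel {Z : Matrix (Fin 3) (Fin 3) ℤ} (hdet : Z.det = 1)
    {α : ℝ} (hα : 1 < α) {a : Fin 3 → ℝ}
    (hZa : (Z.map ((↑) : ℤ → ℝ)).mulVec a = α • a)
    {β : ℂ} (hβ : β.im ≠ 0) {b : Fin 3 → ℂ}
    (hZb : (Z.map ((↑) : ℤ → ℂ)).mulVec b = β • b)
    (hL : IsClosed (inoueLattice a b : Set (ℝ × ℂ))) :
    IsClosed {q : InoueHC × InoueHC |
      MulAction.orbitRel (inoueGroup α β hα hβ a b) InoueHC q.1 q.2} := by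
  have hβ0 : β ≠ 0 := fun h => hβ (by rw [h, Complex.zero_im])
  have hlog : 0 < Real.log α := Real.log_pos hα
  have hα_pos : 0 < α := one_pos.trans hα
  let r : InoueHC × InoueHC → ℝ := fun q => q.1.1.1.im / q.2.1.1.im
  have hr_pos : ∀ q, 0 < r q := fun q => div_pos q.1.1.2 q.2.1.2
  let t : InoueHC × InoueHC → ℝ := fun q => Real.log (r q) / Real.log α
  let d : InoueHC × InoueHC → ℝ × ℂ := fun q =>
    (q.1.1.1.re - r q * q.2.1.1.re, q.1.2 - β ^ (t q : ℂ) * q.2.2)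
  have hr : Continuous r :=
    Continuous.div (by fun_prop) (by fun_prop) fun q => q.2.1.2.ne'
  have ht : Continuous t := (hr.log fun q => (hr_pos q).ne').div_const _
  have hd : Continuous d := by
    have : Continuous fun q => β ^ (t q : ℂ) :=
      Continuous.const_cpow (Complex.continuous_ofReal.comp ht) (Or.inl hβ0)
    fun_prop
  have heq : {q : InoueHC × InoueHC |
      MulAction.orbitRel (inoueGroup α β hα hβ a b) InoueHC q.1 q.2} =
      t ⁻¹' range ((↑) : ℤ → ℝ) ∩ d ⁻¹' (inoueLattice a b) := by
    ext q
    rw [mem_ofPred_eq, inoueGroup_orbitRel_iff hdet hα hZa hβ hZb]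
    constructor
    · rintro ⟨n, x, hx, h₁, h₂⟩
      rw [← Complex.ofReal_zpow] at h₁
      have hrn : r q = α ^ n := by
        rw [div_eq_iff q.2.1.2.ne', h₁]
        simp [-Complex.ofReal_zpow]
      have htn : t q = n := by
        simp only [t]
        rw [hrn, Real.log_zpow, mul_div_cancel_right₀ _ hlog.ne']
      refine ⟨⟨n, htn.symm⟩, ?_⟩
      have : d q = x := by
        refine Prod.ext ?_ ?_
        · simp only [d]
          rw [hrn, h₁, Complex.add_re, Complex.re_ofReal_mul, Complex.ofReal_re]
          ring
        · simp only [d]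
          rw [htn, h₂, Complex.ofReal_intCast, Complex.cpow_intCast]
          ring
      rwa [mem_preimage, this]
    · rintro ⟨⟨n, hn⟩, hx⟩
      have hrn : r q = α ^ n := by
        have : Real.log (r q) = Real.log (α ^ n) := by
          rw [Real.log_zpow, hn, div_mul_cancel₀ _ hlog.ne']
        exact Real.log_injOn_pos (hr_pos q) (zpow_pos hα_pos n) this
      refine ⟨n, d q, hx, ?_, ?_⟩
      · have him : α ^ n * q.2.1.1.im = q.1.1.1.im := by
          rw [← hrn, div_mul_cancel₀ _ q.2.1.2.ne']
        rw [← Complex.ofReal_zpow]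
        apply Complex.ext
        · simp [d, hrn, -Complex.ofReal_zpow]
        · simp [him, -Complex.ofReal_zpow]
      · simp only [d]
        rw [← hn, Complex.ofReal_intCast, Complex.cpow_intCast]
        ring
  rw [heq]
  exact (Int.isClosedEmbedding_coe_real.isClosed_range.preimage ht).inter (hL.preimage hd)

theorem compactSpace_inoueGroup_quotient {Z : Matrix (Fin 3) (Fin 3) ℤ} (hdet : Z.det = 1)
    {α : ℝ} (hα : 1 < α) {a : Fin 3 → ℝ}
    (hZa : (Z.map ((↑) : ℤ → ℝ)).mulVec a = α • a)
    {β : ℂ} (hβ : β.im ≠ 0) {b : Fin 3 → ℂ}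
    (hZb : (Z.map ((↑) : ℤ → ℂ)).mulVec b = β • b)
    {K : Set (ℝ × ℂ)} (hK : IsCompact K) (hKL : ∀ y, ∃ x ∈ inoueLattice a b, y + x ∈ K) :
    CompactSpace (Quotient (MulAction.orbitRel (inoueGroup α β hα hβ a b) InoueHC)) := by
  have hα_pos : 0 < α := one_pos.trans hα
  have hC : IsCompact (Icc 1 α ×ˢ K) := isCompact_Icc.prod hK
  let f : ℝ × ℝ × ℂ → InoueHC := fun u =>
    (⟨⟨u.2.1, max u.1 1⟩, lt_max_of_lt_right one_pos⟩, u.2.2)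
  have hf : Continuous f := by
    refine Continuous.prodMk (continuous_induced_rng.2 ?_) (by fun_prop)
    exact Complex.equivRealProdCLM.symm.continuous.comp
      (f := fun u : ℝ × ℝ × ℂ => (u.2.1, max u.1 1)) (by fun_prop)
  have hq : Continuous (fun u => (Quotient.mk
      (MulAction.orbitRel (inoueGroup α β hα hβ a b) InoueHC) (f u))) :=
    continuous_quot_mk.comp hf
  refine ⟨?_⟩
  convert hC.image hq
  refine (eq_univ_of_forall fun s => ?_).symm
  induction s using Quotient.inductionOn with
  | h p =>
    obtain ⟨n, hn₁, hn₂⟩ := exists_mem_Ico_zpow p.1.2 hα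
    have hαn : 0 < α ^ n := zpow_pos hα_pos n
    obtain ⟨x, hx, hxK⟩ := hKL (α ^ (-n) * p.1.1.re, β ^ (-n) * p.2)
    have him₁ : 1 ≤ α ^ (-n) * p.1.1.im := by
      rw [zpow_neg, inv_mul_eq_div, one_le_div hαn]; exact hn₁
    have him₂ : α ^ (-n) * p.1.1.im ≤ α := by
      rw [zpow_neg, inv_mul_eq_div, div_le_iff₀ hαn, mul_comm, ← zpow_add_one₀ hα_pos.ne']
      exact hn₂.le
    refine ⟨(α ^ (-n) * p.1.1.im, (α ^ (-n) * p.1.1.re, β ^ (-n) * p.2) + x),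
      ⟨⟨him₁, him₂⟩, hxK⟩, Quotient.sound ?_⟩
    refine (inoueGroup_orbitRel_iff hdet hα hZa hβ hZb _ _).2 ⟨-n, x, hx, ?_, rfl⟩
    rw [← Complex.ofReal_zpow]
    apply Complex.ext
    · simp [f, -zpow_neg, -Complex.ofReal_zpow]
    · simp only [f, max_eq_left him₁]
      simp [-zpow_neg, -Complex.ofReal_zpow]

/-- In the Inoue setup, the orbit space `S_Z = (ℍ × ℂ)/G_Z` of the action
of the subgroup `G_Z` generated by `g₀, g₁, g₂, g₃`, equipped with the quotient topology, is
a compact Hausdorff topological space (the Inoue surface associated to the data). -/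
theorem inoue_surface_compact_hausdorff
    (Z : Matrix (Fin 3) (Fin 3) ℤ) (hdet : Z.det = 1)
    (α : ℝ) (hα : 1 < α) (a : Fin 3 → ℝ) (ha : a ≠ 0)
    (hZa : (Z.map ((↑) : ℤ → ℝ)).mulVec a = α • a)
    (β : ℂ) (hβ : β.im ≠ 0) (b : Fin 3 → ℂ) (hb : b ≠ 0)
    (hZb : (Z.map ((↑) : ℤ → ℂ)).mulVec b = β • b) :
    CompactSpace
      (Quotient (MulAction.orbitRel
        (↥(Subgroup.closure {inoueDilat α β hα hβ, inoueTransl (a 0) (b 0),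
          inoueTransl (a 1) (b 1), inoueTransl (a 2) (b 2)}))
        InoueHC)) ∧
    T2Space
      (Quotient (MulAction.orbitRel
        (↥(Subgroup.closure {inoueDilat α β hα hβ, inoueTransl (a 0) (b 0),
          inoueTransl (a 1) (b 1), inoueTransl (a 2) (b 2)}))
        InoueHC)) := by
  have hli := linearIndependent_eigenvector_pairs Z α a ha hZa β hβ b hb hZb
  let B := basisOfLinearIndependentOfCardEqFinrank hli (by simp)
  have hB : inoueLattice a b = Submodule.span ℤ (range B) := by
    simp [B]
  have hL : IsClosed (inoueLattice a b : Set (ℝ × ℂ)) := by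
    have : DiscreteTopology (inoueLattice a b).toAddSubgroup := by
      rw [hB]; infer_instance
    exact AddSubgroup.isClosed_of_discrete (H := (inoueLattice a b).toAddSubgroup)
  refine ⟨compactSpace_inoueGroup_quotient hdet hα hZa hβ hZb
    (ZSpan.fundamentalDomain_isBounded B).isCompact_closure fun y => ?_, ?_⟩
  · rw [hB]
    refine ⟨-(ZSpan.floor B y), neg_mem (ZSpan.floor B y).2, subset_closure ?_⟩
    rw [← sub_eq_add_neg]
    exact ZSpan.fract_mem_fundamentalDomain B y
  · have := continuousConstSMul_inoueGroup hdet hα hZa hβ hZb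
    rw [t2Space_iff_of_isOpenQuotientMap MulAction.isOpenQuotientMap_quotientMk]
    simpa only [Quotient.eq] using isClosed_inoueGroup_orbitRel hdet hα hZa hβ hZb hL

end
end
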